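/- Suppose {a_n}_{n≥0} is periodic with minimal odd period p ≥ 1, let t_0 > 0 be fixed, let {t_n} be the solution of t_{n+1} = e^{a_n}/t_n (which is periodic with period 2p), and define g_k(x) = t_k·x·e^{−x} for k = 0, …, 2p−1 and f = g_{2p−1} ∘ … ∘ g_0. If s > 0 is a periodic point of f with period ω, then the solution of x_{n+1} = x_{n−1}·exp(a_n − x_{n−1} − x_n) with initial values x_{−1} = s and x_0 = t_0·s·e^{−s} is periodic with period 2pω. -/

import Mathlib

/- compDown g k = g k ∘ g (k-1) ∘ ... ∘ g 0 -/
def compDown (g : ℕ → ℝ → ℝ) : ℕ → (ℝ → ℝ)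
  | 0 => g 0
  | k + 1 => g (k + 1) ∘ compDown g k

/-- An orbit of a nonautonomous first-order recurrence is given by `compDown`. -/
theorem orbit_eq_compDown (g : ℕ → ℝ → ℝ) (Y : ℕ → ℝ) (h : ∀ n, Y (n + 1) = g n (Y n)) (k : ℕ) :
    Y (k + 1) = compDown g k (Y 0) := by
  induction k with
  | zero => exact h 0
  | succ k ih => rw [h (k + 1), ih]; rfl

theorem factor_pos {a t : ℕ → ℝ} (ht0 : 0 < t 0)
    (htrec : ∀ n, t (n + 1) = Real.exp (a n) / t n) (n : ℕ) : 0 < t n := by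
  induction n with
  | zero => exact ht0
  | succ n ih => rw [htrec]; positivity

/-- If `a` has odd period `p`, the factor sequence has period `2 * p`. -/
theorem factor_periodic {a t : ℕ → ℝ} {p : ℕ} (hodd : Odd p) (hper : Function.Periodic a p)
    (ht0 : 0 < t 0) (htrec : ∀ n, t (n + 1) = Real.exp (a n) / t n) :
    Function.Periodic t (2 * p) := by
  have hpos := factor_pos ht0 htrec
  have hstep : ∀ n, t (n + 1 + p) / t (n + 1) = (t (n + p) / t n)⁻¹ := by
    intro n
    have h1 := (hpos n).ne'
    have h2 := (hpos (n + p)).ne'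
    rw [show n + 1 + p = n + p + 1 by ring, htrec, htrec, hper n]
    field_simp
  have hinv : ∀ n m, t (n + (2 * m + 1) + p) / t (n + (2 * m + 1)) = (t (n + p) / t n)⁻¹ := by
    intro n m
    induction m with
    | zero => exact hstep n
    | succ m ih =>
      rw [show n + (2 * (m + 1) + 1) = n + (2 * m + 1) + 1 + 1 by ring, hstep, hstep, ih, inv_inv]
  obtain ⟨m, hm⟩ := hodd
  intro n
  have h := hinv n m
  rw [← hm] at h
  have h1 := (hpos n).ne'
  have h2 := (hpos (n + p)).ne'
  rw [inv_div, div_left_inj' h2] at h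
  rw [two_mul, ← add_assoc, h]

/- Statement 15 (Theorem oddgen(a)): {a_n} periodic with minimal odd period p ≥ 1, t_0 > 0
fixed, {t_n} the solution of t_{n+1} = e^{a_n}/t_n.  With g_k(x) = t_k x e^{-x} and
f = g_{2p-1} ∘ ... ∘ g_0, if s > 0 is a periodic point of f with period ω, then the
solution of (E) with x_{-1} = s and x_0 = t_0 s e^{-s} is periodic with period 2pω.
We index X : ℕ → ℝ with X n = x_{n-1}; full periodicity of the solution (including x_{-1})
reads X (n + 2pω) = X n for all n. -/
theorem stmt_15 (a : ℕ → ℝ) (p : ℕ) (hp : 1 ≤ p) (hodd : Odd p)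
    (hper : Function.Periodic a p)
    (hmin : ∀ r : ℕ, 0 < r → Function.Periodic a r → p ≤ r)
    (t : ℕ → ℝ) (ht0 : 0 < t 0)
    (htrec : ∀ n : ℕ, t (n + 1) = Real.exp (a n) / t n)
    (f : ℝ → ℝ) (hf : f = compDown (fun k x => t k * x * Real.exp (-x)) (2 * p - 1))
    (s : ℝ) (hs : 0 < s) (ω : ℕ) (hω : 0 < ω)
    (hsper : ∀ n : ℕ, f^[n + ω] s = f^[n] s)
    (X : ℕ → ℝ) (hX0 : X 0 = s) (hX1 : X 1 = t 0 * s * Real.exp (-s))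
    (hrec : ∀ n : ℕ, X (n + 2) = X n * Real.exp (a n - X n - X (n + 1))) :
    ∀ n : ℕ, X (n + 2 * p * ω) = X n := by
  have hstep : ∀ n, X (n + 1) = t n * X n * Real.exp (-X n) := by
    intro n
    induction n with
    | zero => rw [hX1, hX0]
    | succ n ih =>
      have h := (factor_pos ht0 htrec n).ne'
      rw [hrec, htrec, show a n - X n - X (n + 1) = a n + -X n + -X (n + 1) by ring, Real.exp_add,
        Real.exp_add]
      calc X n * (Real.exp (a n) * Real.exp (-X n) * Real.exp (-X (n + 1)))
          = Real.exp (a n) / t n * (t n * X n * Real.exp (-X n)) * Real.exp (-X (n + 1)) := by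
            field_simp
        _ = _ := by rw [← ih]
  have htper := factor_periodic hodd hper ht0 htrec
  have htmul : ∀ m n, t (n + 2 * p * m) = t n := fun m n => by
    simpa [mul_comm] using htper.nat_mul m n
  have hiter : ∀ m, X (2 * p * m) = f^[m] s := by
    intro m
    induction m with
    | zero => simpa using hX0
    | succ m ih =>
      have h := orbit_eq_compDown (fun k x => t k * x * Real.exp (-x))
        (fun n => X (n + 2 * p * m))
        (fun n => by
          simp only [show n + 1 + 2 * p * m = n + 2 * p * m + 1 by ring]
          rw [hstep, htmul]) (2 * p - 1)
      rw [← hf] at h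
      simp only [zero_add, ih] at h
      rw [Function.iterate_succ_apply', ← h]
      congr 1
      rw [Nat.sub_add_cancel (by omega)]
      ring
  intro n
  induction n with
  | zero =>
    have h := hsper 0
    rw [zero_add] at h
    rw [zero_add, hiter, h, hX0]
    rfl
  | succ n ih =>
    rw [show n + 1 + 2 * p * ω = n + 2 * p * ω + 1 by ring, hstep, hstep, htmul, ih]
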